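/- For real x > 0 and y with y² > x², one has Re(Γ'/Γ)(x + iy) = log|y| − x/(2(x²+y²)) + R(x,y) where |R(x,y)| ≤ 1/(12x|y|) + x²/(2y²). -/

import Mathlib

open Filter Topology Set

/-- The error of the one-step trapezoidal rule for `∫ dt / t` on the segment `[w, w + 1]`. -/
noncomputable def trapezoidError (w : ℂ) : ℂ :=
  Complex.log (w + 1) - Complex.log w - (w⁻¹ + (w + 1)⁻¹) / 2

/-- An antiderivative of `u ↦ u * (1 - u) / (w + u) ^ 3`. -/
noncomputable def trapezoidPrimitive (w : ℂ) (u : ℝ) : ℂ :=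
  -(u * (1 - u) / (w + u) ^ 2) / 2 - (1 - 2 * u) / (w + u) / 2 - Complex.log (w + u)

lemma trapezoidPrimitive_sub (w : ℂ) :
    trapezoidPrimitive w 1 - trapezoidPrimitive w 0 = -trapezoidError w := by
  simp only [trapezoidPrimitive, trapezoidError, Complex.ofReal_one, Complex.ofReal_zero, add_zero]
  ring

lemma hasDerivAt_trapezoidPrimitive {w : ℂ} (hw : 0 < w.re) {u : ℝ} (hu : 0 ≤ u) :
    HasDerivAt (trapezoidPrimitive w) (u * (1 - u) / (w + u) ^ 3) u := by
  have hre : 0 < (w + u).re := by simpa using by linarith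
  have hne : w + u ≠ 0 := fun h => by simp [h] at hre
  have hid : HasDerivAt (fun v : ℂ => v) 1 (u : ℂ) := hasDerivAt_id _
  have hadd : HasDerivAt (fun v : ℂ => w + v) 1 (u : ℂ) := hid.const_add w
  have h := ((((hid.mul (hid.const_sub 1)).div (hadd.pow 2) (pow_ne_zero 2 hne)).neg.div_const
    2).sub ((((hid.const_mul 2).const_sub 1).div hadd hne).div_const 2)).sub
      (hadd.clog (Or.inl hre))
  have h' : HasDerivAt (trapezoidPrimitive w) _ u := h.comp_ofReal
  refine h'.congr_deriv ?_
  simp only [Pi.pow_apply, Pi.mul_apply, Nat.cast_ofNat]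
  field_simp
  ring

lemma norm_deriv_trapezoidPrimitive_le (w : ℂ) {u : ℝ} (h0 : 0 ≤ u) (h1 : u ≤ 1) :
    ‖(u : ℂ) * (1 - u) / (w + u) ^ 3‖ ≤ 1 / 4 / ‖w + u‖ ^ 3 := by
  have h : ‖(u : ℂ) * (1 - u)‖ = u * (1 - u) := by
    rw [← Complex.ofReal_one, ← Complex.ofReal_sub, ← Complex.ofReal_mul, Complex.norm_real,
      Real.norm_of_nonneg (mul_nonneg h0 (sub_nonneg.2 h1))]
  rw [norm_div, norm_pow, h]
  gcongr
  nlinarith [sq_nonneg (2 * u - 1)]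

lemma norm_trapezoidError_le {w : ℂ} (hw : 0 < w.re) :
    ‖trapezoidError w‖ ≤ 1 / 4 / w.re ^ 3 := by
  have h := norm_image_sub_le_of_norm_deriv_le_segment_01' (f := trapezoidPrimitive w)
    (C := 1 / 4 / w.re ^ 3)
    (fun u hu => (hasDerivAt_trapezoidPrimitive hw hu.1).hasDerivWithinAt)
    (fun u hu => (norm_deriv_trapezoidPrimitive_le w hu.1 hu.2.le).trans (by
      gcongr
      refine le_trans ?_ (Complex.re_le_norm _)
      simpa using hu.1))
  rwa [trapezoidPrimitive_sub, norm_neg] at h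

lemma hasDerivAt_div_sqrt_sq_add_sq {y : ℝ} (hy : y ≠ 0) (t : ℝ) :
    HasDerivAt (fun t : ℝ => t / (y ^ 2 * √(t ^ 2 + y ^ 2))) (1 / √(t ^ 2 + y ^ 2) ^ 3) t := by
  have hpos : 0 < t ^ 2 + y ^ 2 := by positivity
  have hs : √(t ^ 2 + y ^ 2) ≠ 0 := (Real.sqrt_pos.2 hpos).ne'
  have hid : HasDerivAt (fun v : ℝ => v) 1 t := hasDerivAt_id _
  have h := hid.div ((((hid.pow 2).add_const (y ^ 2)).sqrt hpos.ne').const_mul (y ^ 2))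
    (mul_ne_zero (pow_ne_zero 2 hy) hs)
  refine h.congr_deriv ?_
  have hsq : √(t ^ 2 + y ^ 2) ^ 2 = t ^ 2 + y ^ 2 := Real.sq_sqrt hpos.le
  simp only [Pi.pow_apply, Nat.cast_ofNat]
  field_simp
  rw [hsq]
  ring

lemma norm_trapezoidError_le_sub {w : ℂ} (hw : 0 < w.re) (hy : w.im ≠ 0) :
    ‖trapezoidError w‖ ≤
      1 / 4 * ((w.re + 1) / (w.im ^ 2 * √((w.re + 1) ^ 2 + w.im ^ 2))
        - w.re / (w.im ^ 2 * √(w.re ^ 2 + w.im ^ 2))) := by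
  have hB (u : ℝ) := (((hasDerivAt_div_sqrt_sq_add_sq hy (w.re + u)).comp_const_add w.re u
    ).sub_const (w.re / (w.im ^ 2 * √(w.re ^ 2 + w.im ^ 2)))).const_mul (1 / 4)
  have h := image_norm_le_of_norm_deriv_right_le_deriv_boundary (a := 0) (b := 1)
    (f := fun u => trapezoidPrimitive w u - trapezoidPrimitive w 0)
    (f' := fun u : ℝ => (u : ℂ) * (1 - u) / (w + u) ^ 3)
    (fun u hu => ((hasDerivAt_trapezoidPrimitive hw hu.1).sub_const
      _).continuousAt.continuousWithinAt)
    (fun u hu => ((hasDerivAt_trapezoidPrimitive hw hu.1).sub_const _).hasDerivWithinAt)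
    (by simp) hB
    (fun u hu => (norm_deriv_trapezoidPrimitive_le w hu.1 hu.2.le).trans_eq (by
      rw [Complex.norm_eq_sqrt_sq_add_sq]
      simp
      ring_nf))
    (right_mem_Icc.2 zero_le_one)
  rwa [trapezoidPrimitive_sub, norm_neg] at h

lemma div_sq_mul_sqrt_le (t : ℝ) {y : ℝ} (hy : y ≠ 0) :
    t / (y ^ 2 * √(t ^ 2 + y ^ 2)) ≤ 1 / y ^ 2 := by
  have hs : 0 < √(t ^ 2 + y ^ 2) := Real.sqrt_pos.2 (by positivity)
  have : t ≤ √(t ^ 2 + y ^ 2) := Real.le_sqrt_of_sq_le (by nlinarith [sq_nonneg y])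
  rw [div_le_div_iff₀ (by positivity) (by positivity)]
  nlinarith [sq_nonneg y]

lemma summable_one_div_nat_add_pow_three {δ : ℝ} (hδ : 0 < δ) :
    Summable fun n : ℕ => 1 / 4 / (δ + n) ^ 3 := by
  have h := ((Real.summable_one_div_nat_add_rpow δ 3).2 (by norm_num)).mul_left (1 / 4)
  refine h.congr fun n => ?_
  rw [abs_of_pos (by positivity), add_comm (n : ℝ)]
  norm_cast
  rw [mul_one_div]

lemma summable_norm_trapezoidError {z : ℂ} (hz : 0 < z.re) :
    Summable fun n : ℕ => ‖trapezoidError (z + n)‖ :=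
  (summable_one_div_nat_add_pow_three hz).of_nonneg_of_le (fun _ => norm_nonneg _) fun n => by
    simpa using norm_trapezoidError_le (w := z + n) (by simpa using by positivity)

lemma norm_tsum_trapezoidError_le {z : ℂ} (hz : 0 < z.re) (hy : z.im ≠ 0) :
    ‖∑' n : ℕ, trapezoidError (z + n)‖ ≤
      1 / 4 * (1 / z.im ^ 2 - z.re / (z.im ^ 2 * √(z.re ^ 2 + z.im ^ 2))) := by
  refine (norm_tsum_le_tsum_norm (summable_norm_trapezoidError hz)).trans ?_
  refine Real.tsum_le_of_sum_range_le (fun _ => norm_nonneg _) fun N => ?_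
  let F : ℕ → ℝ := fun n => (z.re + n) / (z.im ^ 2 * √((z.re + n) ^ 2 + z.im ^ 2))
  calc ∑ n ∈ Finset.range N, ‖trapezoidError (z + n)‖
      ≤ ∑ n ∈ Finset.range N, 1 / 4 * (F (n + 1) - F n) := by
        refine Finset.sum_le_sum fun n _ => ?_
        have h := norm_trapezoidError_le_sub (w := z + n) (by simpa using by positivity)
          (by simpa using hy)
        simpa [F, add_assoc] using h
    _ = 1 / 4 * (F N - F 0) := by rw [← Finset.mul_sum, Finset.sum_range_sub]
    _ ≤ _ := by
        have h := div_sq_mul_sqrt_le (z.re + N) hy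
        simp only [F, Nat.cast_zero, add_zero]
        gcongr

lemma differentiableAt_trapezoidError {w : ℂ} (hw : 0 < w.re) :
    DifferentiableAt ℂ trapezoidError w := by
  have hre : 0 < (w + 1).re := by simpa using by linarith
  have h0 : w ≠ 0 := fun h => by simp [h] at hw
  have h1 : w + 1 ≠ 0 := fun h => by simp [h] at hre
  have hadd : DifferentiableAt ℂ (fun v : ℂ => v + 1) w := by fun_prop
  exact ((hadd.clog (Or.inl hre)).sub (differentiableAt_id.clog (Or.inl hw))).sub
    ((differentiableAt_id.inv h0).add (hadd.inv h1) |>.div_const 2)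

lemma differentiableOn_tsum_trapezoidError :
    DifferentiableOn ℂ (fun z : ℂ => ∑' n : ℕ, trapezoidError (z + n)) {z | 0 < z.re} := by
  intro z hz
  have hz' : 0 < z.re := hz
  have hopen : IsOpen {w : ℂ | z.re / 2 < w.re} := isOpen_lt continuous_const Complex.continuous_re
  have hd : DifferentiableOn ℂ (fun z : ℂ => ∑' n : ℕ, trapezoidError (z + n))
      {w : ℂ | z.re / 2 < w.re} := by
    refine Complex.differentiableOn_tsum_of_summable_norm
      (summable_one_div_nat_add_pow_three (half_pos hz')) (fun n w hw => ?_) hopen fun n w hw => ?_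
    all_goals
      have hw' : z.re / 2 < w.re := hw
      have hre : 0 < (w + n).re := by
        simpa using add_pos_of_pos_of_nonneg ((half_pos hz').trans hw') n.cast_nonneg
    · exact ((differentiableAt_trapezoidError hre).comp w
        (differentiableAt_id.add_const (n : ℂ))).differentiableWithinAt
    · refine (norm_trapezoidError_le hre).trans ?_
      simp only [Complex.add_re, Complex.natCast_re]
      gcongr
  exact (hd.differentiableAt (hopen.mem_nhds (by simpa using hz'))).differentiableWithinAt

lemma Real.abs_logDeriv_Gamma_sub_log_le {r : ℝ} (hr : 1 < r) :
    |logDeriv Real.Gamma r - Real.log r| ≤ 1 / (r - 1) := by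
  have hr0 : 0 < r := by linarith
  have hr1 : 0 < r - 1 := by linarith
  have hc : ConvexOn ℝ (Ioi 0) (Real.log ∘ Real.Gamma) := Real.convexOn_log_Gamma
  have hG : DifferentiableAt ℝ Real.Gamma r :=
    Real.differentiableAt_Gamma fun m => ne_of_gt (by linarith [m.cast_nonneg (α := ℝ)])
  have hd : DifferentiableAt ℝ (Real.log ∘ Real.Gamma) r :=
    hG.log (Real.Gamma_pos_of_pos hr0).ne'
  have hrec (s : ℝ) (hs : 0 < s) : Real.log (Real.Gamma (s + 1)) =
      Real.log (Real.Gamma s) + Real.log s := by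
    rw [Real.Gamma_add_one hs.ne', Real.log_mul hs.ne' (Real.Gamma_pos_of_pos hs).ne', add_comm]
  have hderiv : deriv (Real.log ∘ Real.Gamma) r = logDeriv Real.Gamma r := by
    rw [Function.comp_def, deriv.log hG (Real.Gamma_pos_of_pos hr0).ne', logDeriv_apply]
  have hlow := hc.slope_le_deriv (mem_Ioi.2 hr1) (mem_Ioi.2 hr0) (by linarith) hd
  have hupp := hc.deriv_le_slope (mem_Ioi.2 hr0) (mem_Ioi.2 (by linarith : 0 < r + 1))
    (by linarith) hd
  have h1 := hrec (r - 1) hr1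
  rw [sub_add_cancel] at h1
  simp only [slope_def_field, Function.comp_apply, h1, hrec r hr0, hderiv] at hlow hupp
  have h2 : Real.log r - Real.log (r - 1) ≤ 1 / (r - 1) := by
    rw [← Real.log_div hr0.ne' hr1.ne']
    refine (Real.log_le_sub_one_of_pos (by positivity)).trans_eq ?_
    field_simp
    ring
  have h3 : 0 ≤ 1 / (r - 1) := by positivity
  norm_num at hlow hupp
  rw [abs_le]
  constructor <;> linarith

lemma Complex.digamma_ofReal {r : ℝ} (hr : 0 < r) :
    Complex.digamma r = (logDeriv Real.Gamma r : ℝ) := by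
  have hG : DifferentiableAt ℂ Complex.Gamma r := by
    refine Complex.differentiableAt_Gamma _ fun m h => ?_
    have := congrArg Complex.re h
    simp at this
    linarith [m.cast_nonneg (α := ℝ)]
  have h := hG.hasDerivAt.comp_ofReal
  simp only [Complex.Gamma_ofReal] at h
  have h2 := (Real.differentiableAt_Gamma (s := r) fun m =>
    ne_of_gt (by linarith [m.cast_nonneg (α := ℝ)])).hasDerivAt.ofReal_comp
  rw [Complex.digamma_def, logDeriv_apply, h.unique h2, Complex.Gamma_ofReal, logDeriv_apply,
    Complex.ofReal_div]

lemma tendsto_digamma_sub_log_ofReal_add_nat {r : ℝ} (hr : 0 < r) :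
    Tendsto (fun n : ℕ => Complex.digamma (r + n) - Complex.log (r + n)) atTop (𝓝 0) := by
  have hlim : Tendsto (fun n : ℕ => r + (n : ℝ) - 1) atTop atTop :=
    tendsto_atTop_add_const_right _ _
      (tendsto_atTop_add_const_left _ _ tendsto_natCast_atTop_atTop)
  refine squeeze_zero_norm' ?_ (tendsto_inv_atTop_zero.comp hlim)
  filter_upwards [eventually_ge_atTop 1] with n hn
  have hn' : (1 : ℝ) ≤ n := by exact_mod_cast hn
  have hpos : 0 < r + n := by linarith
  rw [← Complex.ofReal_natCast, ← Complex.ofReal_add, Complex.digamma_ofReal hpos,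
    ← Complex.ofReal_log hpos.le, ← Complex.ofReal_sub, Complex.norm_real, Real.norm_eq_abs]
  simpa using Real.abs_logDeriv_Gamma_sub_log_le (by linarith : 1 < r + n)

lemma digamma_ofReal_eq {r : ℝ} (hr : 0 < r) :
    Complex.digamma r = Complex.log r - (r : ℂ)⁻¹ / 2 + ∑' n : ℕ, trapezoidError (r + n) := by
  let D : ℕ → ℂ := fun n =>
    Complex.digamma (r + n) - Complex.log (r + n) + ((r : ℂ) + n)⁻¹ / 2
  have hstep (n : ℕ) : trapezoidError (r + n) = -(D (n + 1) - D n) := by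
    have hd := Complex.digamma_apply_add_one (r + n) fun m h => by
      have := congrArg Complex.re h
      simp at this
      linarith [m.cast_nonneg (α := ℝ), n.cast_nonneg (α := ℝ)]
    simp only [D, trapezoidError, Nat.cast_add, Nat.cast_one, ← add_assoc, hd]
    ring
  have hinv : Tendsto (fun n : ℕ => ((r : ℂ) + n)⁻¹ / 2) atTop (𝓝 0) := by
    have h := tendsto_inv_atTop_zero.comp
      (tendsto_atTop_add_const_left _ r (tendsto_natCast_atTop_atTop (R := ℝ)))
    have h2 := ((Complex.continuous_ofReal.tendsto 0).comp h).div_const 2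
    simpa [Function.comp_def] using h2
  have hD : Tendsto D atTop (𝓝 0) := by
    simpa using (tendsto_digamma_sub_log_ofReal_add_nat hr).add hinv
  have hsum := (summable_norm_trapezoidError (z := r) (by simpa using hr)).of_norm
    |>.hasSum.tendsto_sum_nat
  have hsum2 : Tendsto (fun N => ∑ n ∈ Finset.range N, trapezoidError (r + n)) atTop
      (𝓝 (D 0)) := by
    simp_rw [hstep, Finset.sum_neg_distrib, Finset.sum_range_sub]
    simpa using (hD.sub_const (D 0)).neg
  rw [tendsto_nhds_unique hsum hsum2]
  simp [D]

lemma digamma_eq_log_sub_add_tsum {z : ℂ} (hz : 0 < z.re) :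
    Complex.digamma z = Complex.log z - z⁻¹ / 2 + ∑' n : ℕ, trapezoidError (z + n) := by
  have hopen : IsOpen {z : ℂ | 0 < z.re} := isOpen_lt continuous_const Complex.continuous_re
  have hpre : IsPreconnected {z : ℂ | 0 < z.re} := (convex_halfSpace_re_gt 0).isPreconnected
  have hGamma : DifferentiableOn ℂ Complex.Gamma {z | 0 < z.re} := fun w hw =>
    (Complex.differentiableAt_Gamma w fun m h => by
      have := congrArg Complex.re h
      have hw' : 0 < w.re := hw
      simp at this
      linarith [m.cast_nonneg (α := ℝ)]).differentiableWithinAt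
  have hf : DifferentiableOn ℂ Complex.digamma {z | 0 < z.re} :=
    (hGamma.deriv hopen).div hGamma fun w hw => Complex.Gamma_ne_zero_of_re_pos hw
  have hg : DifferentiableOn ℂ (fun z : ℂ => Complex.log z - z⁻¹ / 2 +
      ∑' n : ℕ, trapezoidError (z + n)) {z | 0 < z.re} :=
    ((differentiableOn_id.clog fun w hw => Or.inl hw).sub
      ((differentiableOn_id.inv fun w hw h => by
        have hw' : 0 < w.re := hw
        have h' : w = 0 := h
        simp [h'] at hw').div_const 2)).add differentiableOn_tsum_trapezoidError
  refine (hf.analyticOnNhd hopen).eqOn_of_preconnected_of_frequently_eq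
    (hg.analyticOnNhd hopen) hpre (z₀ := ((1 : ℝ) : ℂ)) (by simp) ?_ hz
  have htend : Tendsto Complex.ofReal (𝓝[≠] 1) (𝓝[≠] ((1 : ℝ) : ℂ)) :=
    tendsto_nhdsWithin_of_tendsto_nhds_of_eventually_within _
      (Complex.continuous_ofReal.continuousAt.mono_left nhdsWithin_le_nhds)
      (eventually_mem_nhdsWithin.mono fun r hr => by simpa using hr)
  refine htend.frequently (Eventually.frequently ?_)
  filter_upwards [nhdsWithin_le_nhds (eventually_gt_nhds one_pos)] with r hr
  exact digamma_ofReal_eq hr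

lemma one_div_sq_sub_le {x a : ℝ} (hx : 0 < x) (ha : 0 < a) :
    1 / 4 * (1 / a ^ 2 - x / (a ^ 2 * √(x ^ 2 + a ^ 2))) ≤ 1 / (12 * x * a) := by
  set r := √(x ^ 2 + a ^ 2) with hr
  have hr0 : 0 < r := Real.sqrt_pos.2 (by positivity)
  have hr2 : r ^ 2 = x ^ 2 + a ^ 2 := Real.sq_sqrt (by positivity)
  have hlow : 7 / 10 * (x + a) ≤ r := Real.le_sqrt_of_sq_le (by nlinarith [sq_nonneg (x - a)])
  have hkey : 3 * x * a ≤ r * (r + x) := by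
    nlinarith [mul_le_mul_of_nonneg_left hlow hx.le, sq_nonneg (x - a), sq_nonneg (5 * x - 4 * a)]
  have hmain : 3 * x * (r - x) ≤ a * r := by
    have h : 3 * x * (r - x) * (r + x) ≤ a * r * (r + x) := by
      calc 3 * x * (r - x) * (r + x) = 3 * x * a * a := by linear_combination 3 * x * hr2
        _ ≤ r * (r + x) * a := by gcongr
        _ = _ := by ring
    exact le_of_mul_le_mul_right h (by positivity)
  have heq : 1 / (12 * x * a) - 1 / 4 * (1 / a ^ 2 - x / (a ^ 2 * r)) =
      (a * r - 3 * x * (r - x)) / (12 * x * a ^ 2 * r) := by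
    field_simp
    ring
  have : 0 ≤ (a * r - 3 * x * (r - x)) / (12 * x * a ^ 2 * r) :=
    div_nonneg (by linarith) (by positivity)
  linarith

lemma abs_log_norm_sub_log_abs_im_le (z : ℂ) (hy : z.im ≠ 0) :
    |Real.log ‖z‖ - Real.log (|z.im|)| ≤ z.re ^ 2 / (2 * z.im ^ 2) := by
  have ha : 0 < |z.im| := abs_pos.2 hy
  have hle : |z.im| ≤ ‖z‖ := Complex.abs_im_le_norm z
  have hz : 0 < ‖z‖ := ha.trans_le hle
  rw [abs_of_nonneg (sub_nonneg.2 (Real.log_le_log ha hle)), ← Real.log_div hz.ne' ha.ne']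
  have h := Real.log_le_sub_one_of_pos (x := (‖z‖ / |z.im|) ^ 2) (by positivity)
  rw [Real.log_pow, div_pow, sq_abs, Complex.sq_norm, Complex.normSq_apply] at h
  have heq : (z.re * z.re + z.im * z.im) / z.im ^ 2 - 1 = 2 * (z.re ^ 2 / (2 * z.im ^ 2)) := by
    field_simp
    ring
  rw [heq] at h
  push_cast at h
  linarith

theorem stmt_14 (x y : ℝ) (hx : 0 < x) (hy : x ^ 2 < y ^ 2) :
    ∃ R : ℝ,
      ((deriv Complex.Gamma ((x : ℂ) + (y : ℂ) * Complex.I))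
          / Complex.Gamma ((x : ℂ) + (y : ℂ) * Complex.I)).re
        = Real.log |y| - x / (2 * (x ^ 2 + y ^ 2)) + R ∧
      |R| ≤ 1 / (12 * x * |y|) + x ^ 2 / (2 * y ^ 2) := by
  have hy0 : y ≠ 0 := by
    rintro rfl
    nlinarith
  set z : ℂ := (x : ℂ) + (y : ℂ) * Complex.I with hz
  have hre : z.re = x := by simp [hz]
  have him : z.im = y := by simp [hz]
  have hpsi : deriv Complex.Gamma z / Complex.Gamma z =
      Complex.log z - z⁻¹ / 2 + ∑' n : ℕ, trapezoidError (z + n) :=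
    digamma_eq_log_sub_add_tsum (hre ▸ hx)
  have hinv : (z⁻¹ / 2).re = x / (2 * (x ^ 2 + y ^ 2)) := by
    rw [Complex.div_ofNat_re, Complex.inv_re, Complex.normSq_apply, hre, him, div_div]
    ring_nf
  refine ⟨(∑' n : ℕ, trapezoidError (z + n)).re + (Real.log ‖z‖ - Real.log (|y|)), ?_, ?_⟩
  · rw [hpsi, Complex.add_re, Complex.sub_re, Complex.log_re, hinv]
    ring
  · refine (abs_add_le _ _).trans (add_le_add ?_ ?_)
    · refine (Complex.abs_re_le_norm _).trans ?_
      refine (norm_tsum_trapezoidError_le (hre ▸ hx) (him ▸ hy0)).trans ?_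
      rw [hre, him, ← sq_abs y]
      exact one_div_sq_sub_le hx (abs_pos.2 hy0)
    · simpa only [hre, him] using abs_log_norm_sub_log_abs_im_le z (him ▸ hy0)
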